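/- Let κ > 0 and λ > 0 with λ ≠ √2 κ. Define ṽ_1^κ(r) = i · D_1( exp(e^{-i 3π/4} κ r) - exp(e^{i 3π/4} κ r) ) and ũ_1^λ = D_1 ( sin(λr) + σ (cos(λr) - e^{-λr}) ) with σ = λ/(λ - √2 κ), where (D_1 w)(r) = w'(r) - w(r)/r. Then the (absolutely convergent) integral of their product vanishes: ∫_0^∞ ũ_1^λ(r) ṽ_1^κ(r) dr = 0. That is, the discrete-spectrum eigenfunction ṽ_1^κ of the self-adjoint extension T_{1κ}^2 is orthogonal to each generalized eigenfunction ũ_1^λ of its continuous spectrum. -/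

import Mathlib

open Set MeasureTheory

/-- The differential operation `(D_1 w)(r) = w'(r) - w(r)/r`. -/
noncomputable def D1 (w : ℝ → ℂ) : ℝ → ℂ :=
  fun r => deriv w r - w r / (r : ℂ)

/-- The discrete-spectrum eigenfunction
`ṽ_1^κ = i D_1(exp(e^{-i3π/4} κ r) - exp(e^{i3π/4} κ r))`. -/
noncomputable def vTilde1 (κ : ℝ) : ℝ → ℂ :=
  fun r => Complex.I * D1 (fun s =>
    Complex.exp (Complex.exp (-Complex.I * (3 * Real.pi / 4)) * κ * s)
      - Complex.exp (Complex.exp (Complex.I * (3 * Real.pi / 4)) * κ * s)) r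

/-- The continuous-spectrum generalized eigenfunction
`ũ_1^λ = D_1(sin(λr) + σ(cos(λr) - e^{-λr}))` with `σ = λ/(λ - √2 κ)`. -/
noncomputable def uTilde1 (κ lam : ℝ) : ℝ → ℂ :=
  D1 (fun s => ((Real.sin (lam * s)
    + lam / (lam - Real.sqrt 2 * κ) * (Real.cos (lam * s) - Real.exp (-(lam * s))) : ℝ) : ℂ))

/-- Bounded solutions of `w'''' = l ^ 4 w` on the half-line. -/
noncomputable def oscFun (l A B C : ℝ) (r : ℝ) : ℝ :=
  A * Real.sin (l * r) + B * Real.cos (l * r) + C * Real.exp (-(l * r))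

/-- Decaying solutions of `w'''' = -4 a ^ 4 w` on the half-line. -/
noncomputable def decayFun (a A B : ℝ) (r : ℝ) : ℝ :=
  Real.exp (-(a * r)) * (A * Real.sin (a * r) + B * Real.cos (a * r))

lemma hasDerivAt_oscFun (l A B C r : ℝ) :
    HasDerivAt (oscFun l A B C) (oscFun l (-(l * B)) (l * A) (-(l * C)) r) r := by
  have h : HasDerivAt (fun s : ℝ => l * s) l r := by simpa using (hasDerivAt_id r).const_mul l
  refine (((h.sin.const_mul A).add (h.cos.const_mul B)).add (h.neg.exp.const_mul C)).congr_deriv ?_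
  simp only [oscFun, Pi.neg_apply]
  ring

lemma hasDerivAt_decayFun (a A B r : ℝ) :
    HasDerivAt (decayFun a A B) (decayFun a (-a * A - a * B) (a * A - a * B) r) r := by
  have h : HasDerivAt (fun s : ℝ => a * s) a r := by simpa using (hasDerivAt_id r).const_mul a
  refine (h.neg.exp.mul ((h.sin.const_mul A).add (h.cos.const_mul B))).congr_deriv ?_
  simp only [decayFun, Pi.neg_apply, Pi.add_apply]
  ring

lemma abs_oscFun_le {l r : ℝ} (hl : 0 ≤ l) (hr : 0 ≤ r) (A B C : ℝ) :
    |oscFun l A B C r| ≤ |A| + |B| + |C| := by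
  have he : |Real.exp (-(l * r))| ≤ 1 := by
    rw [Real.abs_exp, Real.exp_le_one_iff]
    nlinarith [mul_nonneg hl hr]
  refine (abs_add_three _ _ _).trans ?_
  rw [abs_mul, abs_mul, abs_mul]
  gcongr ?_ + ?_ + ?_
  · exact mul_le_of_le_one_right (abs_nonneg _) (Real.abs_sin_le_one _)
  · exact mul_le_of_le_one_right (abs_nonneg _) (Real.abs_cos_le_one _)
  · exact mul_le_of_le_one_right (abs_nonneg _) he

lemma abs_decayFun_le (a A B r : ℝ) :
    |decayFun a A B r| ≤ Real.exp (-(a * r)) * (|A| + |B|) := by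
  rw [decayFun, abs_mul, Real.abs_exp]
  gcongr
  refine (abs_add_le _ _).trans ?_
  rw [abs_mul, abs_mul]
  gcongr ?_ + ?_
  · exact mul_le_of_le_one_right (abs_nonneg _) (Real.abs_sin_le_one _)
  · exact mul_le_of_le_one_right (abs_nonneg _) (Real.abs_cos_le_one _)

lemma abs_cos_sub_exp_neg_le {x : ℝ} (hx : 0 ≤ x) : |Real.cos x - Real.exp (-x)| ≤ x := by
  have h1 : 1 - x ≤ Real.cos x := by
    rcases le_total x 2 with h | h
    · nlinarith [Real.one_sub_sq_div_two_le_cos (x := x)]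
    · linarith [Real.neg_one_le_cos x]
  have h2 : Real.exp (-x) ≤ 1 := Real.exp_le_one_iff.2 (by linarith)
  rw [abs_le]
  constructor <;> linarith [Real.cos_le_one x, Real.add_one_le_exp (-x)]

lemma abs_oscFun_div_le {l r : ℝ} (hl : 0 ≤ l) (hr : 0 < r) (c : ℝ) :
    |oscFun l 1 c (-c) r / r| ≤ l * (1 + |c|) := by
  have hlr : 0 ≤ l * r := by positivity
  have h : oscFun l 1 c (-c) r =
      Real.sin (l * r) + c * (Real.cos (l * r) - Real.exp (-(l * r))) := by
    rw [oscFun]; ring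
  rw [abs_div, abs_of_pos hr, div_le_iff₀ hr, h]
  calc _ ≤ |Real.sin (l * r)| + |c| * |Real.cos (l * r) - Real.exp (-(l * r))| := by
        rw [← abs_mul]; exact abs_add_le _ _
    _ ≤ l * r + |c| * (l * r) := by
        gcongr
        · exact Real.abs_sin_le_abs.trans (abs_of_nonneg hlr).le
        · exact abs_cos_sub_exp_neg_le hlr
    _ = _ := by ring

lemma abs_decayFun_div_le {a r : ℝ} (ha : 0 ≤ a) (hr : 0 < r) :
    |decayFun a 1 0 r / r| ≤ Real.exp (-(a * r)) * a := by
  rw [abs_div, abs_of_pos hr, div_le_iff₀ hr, decayFun, abs_mul, Real.abs_exp, mul_assoc]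
  gcongr
  simpa [abs_of_nonneg ha, abs_of_pos hr] using Real.abs_sin_le_abs (x := a * r)

/-- A primitive of the product of `w' - w / r` for the two basic solutions. -/
noncomputable def productPrimitive (l a c : ℝ) (r : ℝ) : ℝ :=
  (oscFun l (l ^ 4) (c * l ^ 4) (-(c * l ^ 4)) r * decayFun a (-a) a r
      - oscFun l (c * l ^ 3) (-l ^ 3) (c * l ^ 3) r * decayFun a 0 (-2 * a ^ 2) r
      + oscFun l (-l ^ 2) (-(c * l ^ 2)) (-(c * l ^ 2)) r * decayFun a (2 * a ^ 3) (2 * a ^ 3) r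
      - oscFun l (-(c * l)) l (c * l) r * decayFun a (-4 * a ^ 4) 0 r) / (l ^ 4 + 4 * a ^ 4)
    - oscFun l 1 c (-c) r * (decayFun a 1 0 r / r)

lemma hasDerivAt_productPrimitive {l : ℝ} (hl : l ≠ 0) (a c : ℝ) {r : ℝ} (hr : r ≠ 0) :
    HasDerivAt (productPrimitive l a c)
      ((oscFun l (-(c * l)) l (c * l) r - oscFun l 1 c (-c) r / r)
        * (decayFun a (-a) a r - decayFun a 1 0 r / r)) r := by
  have hd : l ^ 4 + 4 * a ^ 4 ≠ 0 := by positivity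
  refine (((((((hasDerivAt_oscFun l _ _ _ r).mul (hasDerivAt_decayFun a _ _ r)).sub
    ((hasDerivAt_oscFun l _ _ _ r).mul (hasDerivAt_decayFun a _ _ r))).add
    ((hasDerivAt_oscFun l _ _ _ r).mul (hasDerivAt_decayFun a _ _ r))).sub
    ((hasDerivAt_oscFun l _ _ _ r).mul (hasDerivAt_decayFun a _ _ r))).div_const _).sub
    ((hasDerivAt_oscFun l _ _ _ r).mul
      ((hasDerivAt_decayFun a _ _ r).div (hasDerivAt_id r) hr))).congr_deriv ?_
  simp only [oscFun, decayFun, id, Pi.div_apply]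
  field_simp
  ring

lemma tendsto_exp_neg_mul_atTop {a : ℝ} (ha : 0 < a) :
    Filter.Tendsto (fun r => Real.exp (-(a * r))) Filter.atTop (nhds 0) :=
  Real.tendsto_exp_neg_atTop_nhds_zero.comp (Filter.tendsto_id.const_mul_atTop ha)

lemma tendsto_oscFun_mul_decayFun_atTop {l a : ℝ} (hl : 0 ≤ l) (ha : 0 < a) (A B C D E : ℝ) :
    Filter.Tendsto (fun r => oscFun l A B C r * decayFun a D E r) Filter.atTop (nhds 0) := by
  have h := ((tendsto_exp_neg_mul_atTop ha).mul_const (|D| + |E|)).const_mul (|A| + |B| + |C|)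
  rw [zero_mul, mul_zero] at h
  refine squeeze_zero_norm' ?_ h
  filter_upwards [Filter.eventually_ge_atTop 0] with r hr
  rw [Real.norm_eq_abs, abs_mul]
  gcongr
  · exact abs_oscFun_le hl hr A B C
  · exact abs_decayFun_le a D E r

lemma tendsto_productPrimitive_atTop {l a : ℝ} (hl : 0 ≤ l) (ha : 0 < a) (c : ℝ) :
    Filter.Tendsto (productPrimitive l a c) Filter.atTop (nhds 0) := by
  have h := tendsto_oscFun_mul_decayFun_atTop hl ha
  have := (((((h (l ^ 4) (c * l ^ 4) (-(c * l ^ 4)) (-a) a).sub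
    (h (c * l ^ 3) (-l ^ 3) (c * l ^ 3) 0 (-2 * a ^ 2))).add
    (h (-l ^ 2) (-(c * l ^ 2)) (-(c * l ^ 2)) (2 * a ^ 3) (2 * a ^ 3))).sub
    (h (-(c * l)) l (c * l) (-4 * a ^ 4) 0)).div_const (l ^ 4 + 4 * a ^ 4)).sub
    ((h 1 c (-c) 1 0).mul tendsto_inv_atTop_zero)
  simp only [sub_zero, add_zero, zero_div, mul_zero] at this
  refine this.congr fun r => ?_
  simp only [productPrimitive, div_eq_mul_inv, mul_assoc]

lemma continuous_oscFun (l A B C : ℝ) : Continuous (oscFun l A B C) := by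
  unfold oscFun; fun_prop

lemma continuous_decayFun (a A B : ℝ) : Continuous (decayFun a A B) := by
  unfold decayFun; fun_prop

lemma productPrimitive_zero {l a : ℝ} (hne : l ≠ 2 * a) :
    productPrimitive l a (l / (l - 2 * a)) 0 = 0 := by
  set c := l / (l - 2 * a)
  have hcl : c * (l - 2 * a) = l := div_mul_cancel₀ l (sub_ne_zero.2 hne)
  rw [productPrimitive, div_zero, mul_zero, sub_zero]
  refine div_eq_zero_iff.2 (Or.inl ?_)
  simp only [oscFun, decayFun, mul_zero, Real.sin_zero, Real.cos_zero, neg_zero, Real.exp_zero]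
  linear_combination (2 * a ^ 2 * l ^ 2) * hcl

lemma continuousWithinAt_productPrimitive {a : ℝ} (ha : 0 ≤ a) (l c : ℝ) :
    ContinuousWithinAt (productPrimitive l a c) (Ici 0) 0 := by
  have hb : Filter.Tendsto (fun r => oscFun l 1 c (-c) r * (decayFun a 1 0 r / r))
      (nhdsWithin 0 (Ioi 0)) (nhds 0) := by
    have hcont : Continuous fun r => |oscFun l 1 c (-c) r| * (Real.exp (-(a * r)) * a) := by
      have := continuous_oscFun l 1 c (-c)
      fun_prop
    have h := (hcont.tendsto 0).mono_left (nhdsWithin_le_nhds (s := Ioi 0))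
    simp only [oscFun, mul_zero, Real.sin_zero, Real.cos_zero, neg_zero, Real.exp_zero, mul_one,
      zero_add, add_neg_cancel, abs_zero, zero_mul] at h
    refine squeeze_zero_norm' ?_ h
    filter_upwards [self_mem_nhdsWithin] with r hr
    rw [Real.norm_eq_abs, abs_mul]
    exact mul_le_mul_of_nonneg_left (abs_decayFun_div_le ha hr) (abs_nonneg _)
  rw [← continuousWithinAt_Ioi_iff_Ici]
  refine ContinuousWithinAt.sub (Continuous.continuousWithinAt ?_) ?_
  · unfold oscFun decayFun
    fun_prop
  · rwa [ContinuousWithinAt, div_zero, mul_zero]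

lemma integrableOn_oscFun_mul_decayFun {l a : ℝ} (hl : 0 ≤ l) (ha : 0 < a) (c : ℝ) :
    IntegrableOn (fun r => (oscFun l (-(c * l)) l (c * l) r - oscFun l 1 c (-c) r / r)
        * (decayFun a (-a) a r - decayFun a 1 0 r / r)) (Ioi 0) := by
  have hexp : IntegrableOn (fun r => Real.exp (-(a * r))) (Ioi 0) := by
    simpa only [neg_mul] using exp_neg_integrableOn_Ioi 0 ha
  refine (hexp.const_mul ((|(-(c * l))| + |l| + |c * l| + l * (1 + |c|))
    * (|-a| + |a| + a))).mono' ?_ ?_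
  · have h1 := fun A B C => (continuous_oscFun l A B C).measurable
    have h2 := fun A B => (continuous_decayFun a A B).measurable
    exact (((h1 _ _ _).sub ((h1 _ _ _).div measurable_id)).mul
      ((h2 _ _).sub ((h2 _ _).div measurable_id))).aestronglyMeasurable
  · filter_upwards [ae_restrict_mem measurableSet_Ioi] with r hr
    have hr : 0 < r := hr
    rw [Real.norm_eq_abs, abs_mul, mul_assoc]
    refine mul_le_mul ?_ ?_ (abs_nonneg _) (by positivity)
    · exact (abs_sub _ _).trans
        (add_le_add (abs_oscFun_le hl hr.le _ _ _) (abs_oscFun_div_le hl hr c))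
    · refine (abs_sub _ _).trans
        ((add_le_add (abs_decayFun_le a _ _ r) (abs_decayFun_div_le ha.le hr)).trans_eq ?_)
      ring

lemma D1_ofReal {f : ℝ → ℝ} {f' r : ℝ} (h : HasDerivAt f f' r) :
    D1 (fun s => (f s : ℂ)) r = ((f' - f r / r : ℝ) : ℂ) := by
  rw [D1, h.ofReal_comp.deriv]
  push_cast
  rfl

lemma uTilde1_eq (κ lam r : ℝ) :
    uTilde1 κ lam r = ((oscFun lam (-(lam / (lam - Real.sqrt 2 * κ) * lam)) lam
        (lam / (lam - Real.sqrt 2 * κ) * lam) r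
      - oscFun lam 1 (lam / (lam - Real.sqrt 2 * κ)) (-(lam / (lam - Real.sqrt 2 * κ))) r / r
      : ℝ) : ℂ) := by
  set c := lam / (lam - Real.sqrt 2 * κ) with hc
  have h := D1_ofReal (hasDerivAt_oscFun lam 1 c (-c) r)
  have e : uTilde1 κ lam = D1 fun s => (oscFun lam 1 c (-c) s : ℂ) := by
    rw [uTilde1]
    congr 1
    ext s
    rw [oscFun, ← hc]
    congr 1
    ring
  rw [e, h]
  congr 2
  simp only [oscFun]
  ring

lemma exp_three_pi_div_four (κ : ℝ) :
    Complex.exp (Complex.I * (3 * Real.pi / 4)) * κ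
      = ((Real.sqrt 2 * κ / 2 : ℝ) : ℂ) * (-1 + Complex.I) := by
  have h : Complex.I * (3 * Real.pi / 4) = ((Real.pi - Real.pi / 4 : ℝ) : ℂ) * Complex.I := by
    push_cast; ring
  rw [h, Complex.exp_mul_I, ← Complex.ofReal_cos, ← Complex.ofReal_sin, Real.cos_pi_sub,
    Real.sin_pi_sub, Real.cos_pi_div_four, Real.sin_pi_div_four]
  push_cast
  ring

lemma exp_neg_three_pi_div_four (κ : ℝ) :
    Complex.exp (-Complex.I * (3 * Real.pi / 4)) * κ
      = ((Real.sqrt 2 * κ / 2 : ℝ) : ℂ) * (-1 - Complex.I) := by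
  have h : -Complex.I * (3 * Real.pi / 4) = ((-(Real.pi - Real.pi / 4) : ℝ) : ℂ) * Complex.I := by
    push_cast; ring
  rw [h, Complex.exp_mul_I, ← Complex.ofReal_cos, ← Complex.ofReal_sin, Real.cos_neg, Real.sin_neg,
    Real.cos_pi_sub, Real.sin_pi_sub, Real.cos_pi_div_four, Real.sin_pi_div_four]
  push_cast
  ring

lemma exp_sub_exp_eq_decayFun (a s : ℝ) :
    Complex.exp (a * (-1 - Complex.I) * s) - Complex.exp (a * (-1 + Complex.I) * s)
      = -2 * Complex.I * (decayFun a 1 0 s : ℂ) := by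
  have h1 : (a : ℂ) * (-1 - Complex.I) * s = -(a * s : ℂ) + (-(a * s : ℂ)) * Complex.I := by ring
  have h2 : (a : ℂ) * (-1 + Complex.I) * s = -(a * s : ℂ) + (a * s : ℂ) * Complex.I := by ring
  rw [h1, h2, Complex.exp_add, Complex.exp_add, Complex.exp_mul_I, Complex.exp_mul_I,
    Complex.cos_neg, Complex.sin_neg, decayFun]
  push_cast
  ring

lemma vTilde1_eq (κ r : ℝ) :
    vTilde1 κ r = ((2 * (decayFun (Real.sqrt 2 * κ / 2) (-(Real.sqrt 2 * κ / 2))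
        (Real.sqrt 2 * κ / 2) r - decayFun (Real.sqrt 2 * κ / 2) 1 0 r / r) : ℝ) : ℂ) := by
  simp only [vTilde1, exp_three_pi_div_four, exp_neg_three_pi_div_four, exp_sub_exp_eq_decayFun]
  set a := Real.sqrt 2 * κ / 2
  have h := hasDerivAt_decayFun a 1 0 r
  rw [D1, (h.ofReal_comp.const_mul (-2 * Complex.I)).deriv]
  have e : decayFun a (-a * 1 - a * 0) (a * 1 - a * 0) r = decayFun a (-a) a r := by simp
  rw [e]
  push_cast
  linear_combination (-2 * ((decayFun a (-a) a r : ℂ) - decayFun a 1 0 r / r)) * Complex.I_sq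

/-- Orthogonality of the discrete eigenfunction `ṽ_1^κ` of `T_{1κ}²` to each
generalized eigenfunction `ũ_1^λ` of its continuous spectrum: the integral of
their product over `(0,∞)` converges absolutely and vanishes. -/
theorem stmt19 (κ lam : ℝ) (hκ : 0 < κ) (hlam : 0 < lam)
    (hne : lam ≠ Real.sqrt 2 * κ) :
    IntegrableOn (fun r => uTilde1 κ lam r * vTilde1 κ r) (Ioi 0) ∧
    ∫ r in Ioi (0 : ℝ), uTilde1 κ lam r * vTilde1 κ r = 0 := by
  set a := Real.sqrt 2 * κ / 2 with ha_def
  have ha : 0 < a := by positivity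
  have h2a : Real.sqrt 2 * κ = 2 * a := by rw [ha_def]; ring
  have hint := integrableOn_oscFun_mul_decayFun hlam.le ha (lam / (lam - 2 * a))
  have hzero := integral_Ioi_of_hasDerivAt_of_tendsto
    (continuousWithinAt_productPrimitive ha.le lam (lam / (lam - 2 * a)))
    (fun r hr => hasDerivAt_productPrimitive hlam.ne' a _ (ne_of_gt hr)) hint
    (tendsto_productPrimitive_atTop hlam.le ha _)
  rw [productPrimitive_zero (h2a ▸ hne), sub_zero] at hzero
  set F := fun r => (oscFun lam (-(lam / (lam - 2 * a) * lam)) lam (lam / (lam - 2 * a) * lam) r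
    - oscFun lam 1 (lam / (lam - 2 * a)) (-(lam / (lam - 2 * a))) r / r)
      * (decayFun a (-a) a r - decayFun a 1 0 r / r) with hF
  have huv : (fun r => uTilde1 κ lam r * vTilde1 κ r) = fun r => ((2 * F r : ℝ) : ℂ) := by
    ext r
    rw [uTilde1_eq, vTilde1_eq, ← ha_def, h2a, hF]
    push_cast
    ring
  rw [huv]
  refine ⟨(hint.const_mul 2).ofReal, ?_⟩
  rw [integral_complex_ofReal, integral_const_mul, hzero, mul_zero, Complex.ofReal_zero]
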